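/- (Tails of the invariant measure.) Assume the standard Markov chain setup and the L-drift condition L(V,φ,Ψ). Let D : [1,∞) → [1,∞) be any increasing function with D(r) → ∞ as r → ∞, and for q ∈ (0,1) set L_q(r) = r φ(1/r) Ψ(r/(1−q)²) D(r). Then for any q ∈ (0,1) there exists a constant c_q ∈ (0,1) such that c_q / L_q(r) ≤ π({x ∈ 𝒳 : V(x) ≥ r}) for all r ∈ [1,∞). -/

import Mathlib

open MeasureTheory ProbabilityTheory Filter Set
open scoped ENNReal NNReal

noncomputable section

/-- A time-homogeneous Markov chain on a measurable space `𝒳`: a Markov transition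
kernel `P` together with the path-space law `law x` of the chain started at `x`.
The field `law_markov` is the Markov property: for any event `C` depending only on the
first `n+1` coordinates, `ℙ_x(C ∩ {X_{n+1} ∈ A}) = ∫_C P(X_n, A) dℙ_x`. -/
structure MarkovChain (𝒳 : Type*) [MeasurableSpace 𝒳] where
  P : ProbabilityTheory.Kernel 𝒳 𝒳
  isMarkov : IsMarkovKernel P
  law : 𝒳 → Measure (ℕ → 𝒳)
  law_prob : ∀ x, IsProbabilityMeasure (law x)
  law_meas : Measurable law
  law_start : ∀ x, law x {ω | ω 0 = x} = 1
  law_markov : ∀ (x : 𝒳) (n : ℕ) (C : Set (ℕ → 𝒳)) (A : Set 𝒳),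
    MeasurableSet C → MeasurableSet A →
    (∀ ω ω' : ℕ → 𝒳, (∀ i ≤ n, ω i = ω' i) → (ω ∈ C ↔ ω' ∈ C)) →
    law x (C ∩ {ω | ω (n + 1) ∈ A}) = ∫⁻ ω in C, P (ω n) A ∂(law x)

namespace MarkovChain

variable {𝒳 : Type*} [MeasurableSpace 𝒳]

/-- `mc.stepDist x n` is the law of `X_n` under `ℙ_x`, i.e. the `n`-step transition
probability `P^n(x, ·)`. -/
def stepDist (mc : MarkovChain 𝒳) (x : 𝒳) (n : ℕ) : Measure 𝒳 :=
  (mc.law x).map (fun ω => ω n)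

end MarkovChain

/-- First hitting time of the set `s` by the path `ω` (equal to `⊤` if `s` is never hit). -/
def hitTime {𝒳 : Type*} (s : Set 𝒳) (ω : ℕ → 𝒳) : ℕ∞ :=
  ⨅ (n : ℕ) (_ : ω n ∈ s), (n : ℕ∞)

/-- First return time to `B` after time `k` : `τ_B(k) = inf {n ≥ k : ω n ∈ B}`. -/
def returnTime {𝒳 : Type*} (B : Set 𝒳) (k : ℕ) (ω : ℕ → 𝒳) : ℕ∞ :=
  ⨅ (n : ℕ) (_ : k ≤ n ∧ ω n ∈ B), (n : ℕ∞)

/-- The set of paths along which `V` has `limsup_{n→∞} V(X_n) = ∞`. -/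
def nonConfined {𝒳 : Type*} (V : 𝒳 → ℝ) : Set (ℕ → 𝒳) :=
  {ω | ∀ M : ℝ, ∃ᶠ n in atTop, M < V (ω n)}

/-- The `f`-variation distance between two (finite) measures:
`‖μ - ν‖_f = sup { |∫ g dμ - ∫ g dν| : g measurable, |g| ≤ f }`. -/
def fVar {𝒳 : Type*} [MeasurableSpace 𝒳] (f : 𝒳 → ℝ) (μ ν : Measure 𝒳) : ℝ :=
  ⨆ g : {g : 𝒳 → ℝ // Measurable g ∧ ∀ x, |g x| ≤ f x},
    |(∫ x, (g : 𝒳 → ℝ) x ∂μ) - ∫ x, (g : 𝒳 → ℝ) x ∂ν|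

/-- The standard setup: ergodic Markov chain with invariant probability measure `π`;
the chain is Feller, positive Harris recurrent and converges to `π` in total variation
from every starting point (hence aperiodic and `π`-irreducible). -/
structure StdSetup {𝒳 : Type*} [TopologicalSpace 𝒳] [MeasurableSpace 𝒳]
    (mc : MarkovChain 𝒳) where
  π : Measure 𝒳
  π_prob : IsProbabilityMeasure π
  π_inv : π.bind (fun x => mc.P x) = π
  feller : ∀ (n : ℕ) (O : Set 𝒳), IsOpen O →
    LowerSemicontinuous fun x => (mc.stepDist x n O).toReal
  harris : ∀ (x : 𝒳) (A : Set 𝒳), MeasurableSet A → 0 < π A →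
    mc.law x {ω | ∃ᶠ n in atTop, ω n ∈ A} = 1
  ergodic_tv : ∀ x : 𝒳,
    Tendsto (fun n => fVar (fun _ => (1 : ℝ)) (mc.stepDist x n) π) atTop (nhds 0)

/-- The L-drift condition `L(V, φ, Ψ)` of the paper. -/
structure LDrift {𝒳 : Type*} [TopologicalSpace 𝒳] [MeasurableSpace 𝒳]
    (mc : MarkovChain 𝒳) (V : 𝒳 → ℝ) (φ : ℝ → ℝ) (Ψ : ℝ → ℝ) where
  V_one_le : ∀ x, 1 ≤ V x
  V_cont : Continuous V
  nonconf : ∀ x, mc.law x (nonConfined V) = 1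
  ℓ₀ : ℝ
  one_le_ℓ₀ : 1 ≤ ℓ₀
  φ_nonneg : ∀ r ∈ Set.Ioc (0 : ℝ) 1, 0 ≤ φ r
  φ_cont : ContinuousOn φ (Set.Ioc 0 1)
  rφ_anti : StrictAntiOn (fun r => r * φ (1 / r)) (Set.Ici (1 : ℝ))
  rφ_lim : Tendsto (fun r => r * φ (1 / r)) atTop (nhds 0)
  b : ℝ
  b_nonneg : 0 ≤ b
  drift : ∀ x, (∫ y, (V y)⁻¹ ∂(mc.P x)) - φ ((V x)⁻¹) ≤
    (V x)⁻¹ - (if V x ≤ ℓ₀ then b else 0)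
  Ψ_one_le : ∀ r, 1 ≤ r → 1 ≤ Ψ r
  Ψ_diff : DifferentiableOn ℝ Ψ (Set.Ici 1)
  Ψ_mono : StrictMonoOn Ψ (Set.Ici 1)
  Ψ_submul : ∃ C : ℝ, 0 < C ∧ ∀ r₁ r₂, 1 ≤ r₁ → 1 ≤ r₂ → Ψ (r₁ + r₂) ≤ C * Ψ r₁ * Ψ r₂
  Cconst : ℝ → ℝ → ℝ
  Cconst_mem : ∀ ℓ m, ℓ₀ < ℓ → 0 < m → Cconst ℓ m ∈ Set.Ioo (0 : ℝ) 1
  hit_lb : ∀ ℓ m, ℓ₀ < ℓ → 0 < m → ∀ r, ℓ + m < r → ∀ x, ℓ + m ≤ V x →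
    ENNReal.ofReal (Cconst ℓ m / Ψ r) ≤
      mc.law x {ω | hitTime {y | r < V y} ω < hitTime {y | V y < ℓ} ω}

/-- `G_h(r) = q (1-q) h(r) / (r φ(1/r))`. -/
def Gfun (q : ℝ) (φ h : ℝ → ℝ) (r : ℝ) : ℝ := q * (1 - q) * h r / (r * φ (1 / r))

/-- A function is locally integrable at infinity if it is integrable on `[l, ∞)`
for some `l ≥ 0`. -/
def L1locInfty (f : ℝ → ℝ) : Prop := ∃ l : ℝ, 0 ≤ l ∧ MeasureTheory.IntegrableOn f (Set.Ici l)

open scoped Classical in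
/-- The modulated sum `∑_{k=0}^{T(ω)} h(V(ω_k))` (with value in `ℝ≥0∞`, the sum being a
series when `T(ω) = ∞`). -/
def modSum {𝒳 : Type*} (h : ℝ → ℝ) (V : 𝒳 → ℝ) (T : (ℕ → 𝒳) → ℕ∞) (ω : ℕ → 𝒳) : ℝ≥0∞ :=
  ∑' n : ℕ, if (n : ℕ∞) ≤ T ω then ENNReal.ofReal (h (V (ω n))) else 0

/-- Convergence in distribution of a sequence of laws on `ℝ`: integrals of bounded
continuous functions converge. -/
def TendstoInDistribution (μs : ℕ → Measure ℝ) (ν : Measure ℝ) : Prop :=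
  ∀ f : BoundedContinuousFunction ℝ ℝ,
    Tendsto (fun n => ∫ z, f z ∂(μs n)) atTop (nhds (∫ z, f z ∂ν))

/-- The ergodic average `S_n(g)(ω) = (1/n) ∑_{k=0}^{n-1} g(ω_k)`. -/
def ergAvg {𝒳 : Type*} (g : 𝒳 → ℝ) (n : ℕ) (ω : ℕ → 𝒳) : ℝ :=
  (∑ k ∈ Finset.range n, g (ω k)) / n

/-- The CLT holds for the ergodic average `S_n(g)`: there is `σ² ∈ (0,∞)` with
`√n (S_n(g) − π(g)) → N(0,σ²)` in distribution for every starting state. -/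
def CLTholds {𝒳 : Type*} [MeasurableSpace 𝒳] (mc : MarkovChain 𝒳) (π : Measure 𝒳)
    (g : 𝒳 → ℝ) : Prop :=
  ∃ σ2 : NNReal, 0 < σ2 ∧ ∀ x : 𝒳,
    TendstoInDistribution
      (fun n => (mc.law x).map fun ω => Real.sqrt n * (ergAvg g n ω - ∫ y, g y ∂π))
      (gaussianReal 0 σ2)

end

namespace ProbabilityTheory.Kernel

variable {𝒳 : Type*} [MeasurableSpace 𝒳]

/-- If `w` vanishes on `B` and `w ≤ 𝟙_A + P w` off `B`, then `∫_B P w dπ ≤ π A` for every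
measure `π` invariant under `P` for which `w` has finite integral. -/
lemma setLIntegral_lintegral_le_of_subsolution {P : Kernel 𝒳 𝒳} {π : Measure 𝒳}
    (hinv : π.bind (fun x => P x) = π) {A B : Set 𝒳} (hA : MeasurableSet A)
    (hB : MeasurableSet B) {w : 𝒳 → ℝ≥0∞} (hw : Measurable w) (hwB : ∀ x ∈ B, w x = 0)
    (hsub : ∀ x ∉ B, w x ≤ A.indicator 1 x + ∫⁻ y, w y ∂P x) (hfin : ∫⁻ x, w x ∂π ≠ ∞) :
    ∫⁻ x in B, ∫⁻ y, w y ∂P x ∂π ≤ π A := by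
  have hPw : Measurable fun x => ∫⁻ y, w y ∂P x := hw.lintegral_kernel
  have hstat : ∫⁻ x, w x ∂π = ∫⁻ x, ∫⁻ y, w y ∂P x ∂π := by
    conv_lhs => rw [← hinv]
    exact Measure.lintegral_bind P.measurable.aemeasurable hw.aemeasurable
  have hsplit := lintegral_add_compl (μ := π) (fun x => ∫⁻ y, w y ∂P x) hB
  have hle : ∫⁻ x, w x ∂π ≤ π A + ∫⁻ x in Bᶜ, ∫⁻ y, w y ∂P x ∂π := by
    rw [← lintegral_add_compl w hB, setLIntegral_congr_fun hB hwB, lintegral_zero, zero_add]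
    calc ∫⁻ x in Bᶜ, w x ∂π
        ≤ ∫⁻ x in Bᶜ, (A.indicator 1 x + ∫⁻ y, w y ∂P x) ∂π :=
          setLIntegral_mono' hB.compl hsub
      _ = ∫⁻ x in Bᶜ, A.indicator 1 x ∂π + ∫⁻ x in Bᶜ, ∫⁻ y, w y ∂P x ∂π :=
          lintegral_add_right _ hPw
      _ ≤ π A + ∫⁻ x in Bᶜ, ∫⁻ y, w y ∂P x ∂π := by
          gcongr
          rw [lintegral_indicator_one hA]
          exact Measure.restrict_apply_le _ _
  rw [hstat, ← hsplit] at hle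
  refine (ENNReal.add_le_add_iff_right (ne_top_of_le_ne_top hfin ?_)).1 hle
  rw [hstat]
  exact setLIntegral_le_lintegral _ _

open scoped Classical in
/-- The probability that a chain with transition kernel `P` visits `U` within `n` steps
while staying in `E` before. -/
noncomputable def hitProb (P : Kernel 𝒳 𝒳) (U E : Set 𝒳) : ℕ → 𝒳 → ℝ≥0∞
  | 0 => U.indicator 1
  | n + 1 => fun x =>
      if x ∈ U then 1 else if x ∈ E then ∫⁻ y, hitProb P U E n y ∂P x else 0

variable {P : Kernel 𝒳 𝒳} {U E : Set 𝒳}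

lemma measurable_hitProb (hU : MeasurableSet U) (hE : MeasurableSet E) (n : ℕ) :
    Measurable (hitProb P U E n) := by
  induction n with
  | zero => exact measurable_one.indicator hU
  | succ n ih =>
    exact Measurable.ite hU measurable_const
      (Measurable.ite hE ih.lintegral_kernel measurable_const)

lemma hitProb_le_one [IsMarkovKernel P] (n : ℕ) (x : 𝒳) : hitProb P U E n x ≤ 1 := by
  induction n generalizing x with
  | zero => exact indicator_le_self' (by simp) x
  | succ n ih =>
    simp only [hitProb]
    split_ifs
    · exact le_rfl
    · exact (lintegral_mono ih).trans (by simp)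
    · exact zero_le

lemma monotone_hitProb : Monotone (hitProb P U E) := by
  refine monotone_nat_of_le_succ fun n => ?_
  induction n with
  | zero =>
    intro x
    by_cases hx : x ∈ U <;> simp [hitProb, hx]
  | succ n ih =>
    intro x
    simp only [hitProb]
    split_ifs
    · exact le_rfl
    · exact lintegral_mono ih
    · exact le_rfl

lemma hitProb_of_mem (n : ℕ) {x : 𝒳} (hx : x ∈ U) : hitProb P U E n x = 1 := by
  cases n <;> simp [hitProb, hx]

lemma hitProb_of_notMem (n : ℕ) {x : 𝒳} (hU : x ∉ U) (hE : x ∉ E) :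
    hitProb P U E n x = 0 := by
  cases n <;> simp [hitProb, hU, hE]

lemma iSup_hitProb_eq_lintegral (hU : MeasurableSet U) (hE : MeasurableSet E) {x : 𝒳}
    (hxU : x ∉ U) (hxE : x ∈ E) :
    ⨆ n, hitProb P U E n x = ∫⁻ y, ⨆ n, hitProb P U E n y ∂P x := by
  rw [lintegral_iSup (measurable_hitProb hU hE) monotone_hitProb]
  refine le_antisymm (iSup_le fun n => ?_) (iSup_le fun n => ?_)
  · refine le_iSup_of_le n ((monotone_hitProb n.le_succ x).trans ?_)
    simp [hitProb, hxU, hxE]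
  · refine le_iSup_of_le (n + 1) ?_
    simp [hitProb, hxU, hxE]

end ProbabilityTheory.Kernel

namespace MarkovChain

variable {𝒳 : Type*} [MeasurableSpace 𝒳] (mc : MarkovChain 𝒳)

lemma law_preimage_zero (x : 𝒳) {S : Set 𝒳} (hS : MeasurableSet S) (hx : x ∉ S) :
    mc.law x {ω | ω 0 ∈ S} = 0 := by
  have := mc.law_prob x
  have hmeas : MeasurableSet {ω : ℕ → 𝒳 | ω 0 ∈ S} := measurable_pi_apply 0 hS
  have h := prob_compl_eq_one_iff (μ := mc.law x) hmeas
  refine h.1 (le_antisymm prob_le_one ?_)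
  rw [← mc.law_start x]
  refine measure_mono fun ω hω => ?_
  simp only [mem_ofPred_eq] at hω
  simp [hω, hx]

lemma map_law_zero (x : 𝒳) : (mc.law x).map (fun ω => ω 0) = Measure.dirac x := by
  have := mc.law_prob x
  ext S hS
  rw [Measure.map_apply (measurable_pi_apply 0) hS, Measure.dirac_apply' _ hS]
  change mc.law x {ω | ω 0 ∈ S} = _
  by_cases hx : x ∈ S
  · have h := mc.law_preimage_zero x hS.compl (by simpa using hx)
    simpa [hx] using (prob_compl_eq_zero_iff (μ := mc.law x) (s := {ω | ω 0 ∈ S})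
      (measurable_pi_apply 0 hS)).1 h
  · simpa [hx] using mc.law_preimage_zero x hS hx

lemma law_preimage_succ (x : 𝒳) (n : ℕ) {S : Set 𝒳} (hS : MeasurableSet S) :
    mc.law x {ω | ω (n + 1) ∈ S} = ∫⁻ ω, mc.P (ω n) S ∂mc.law x := by
  simpa using mc.law_markov x n univ S MeasurableSet.univ hS (by simp)

lemma ae_law_preimage_eq_zero {π : Measure 𝒳} (hinv : π.bind (fun x => mc.P x) = π)
    (n : ℕ) {S : Set 𝒳} (hS : MeasurableSet S) (hπ : π S = 0) :
    ∀ᵐ x ∂π, mc.law x {ω | ω n ∈ S} = 0 := by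
  induction n generalizing S with
  | zero =>
    filter_upwards [measure_eq_zero_iff_ae_notMem.1 hπ] with x hx
    exact mc.law_preimage_zero x hS hx
  | succ n ih =>
    have hm : Measurable fun x => mc.P x S := mc.P.measurable_coe hS
    have hnull : π {y | mc.P y S ≠ 0} = 0 := by
      rw [← hinv, Measure.bind_apply hS mc.P.measurable.aemeasurable,
        lintegral_eq_zero_iff hm] at hπ
      exact hπ
    filter_upwards [ih (hm (measurableSet_singleton 0).compl) hnull] with x hx
    rw [mc.law_preimage_succ x n hS]
    exact (lintegral_eq_zero_iff (hm.comp (measurable_pi_apply (X := fun _ => 𝒳) n))).2 hx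

/-- The law of the chain at time `n` on the event that it has stayed in `E` up to time `n`. -/
noncomputable def tabooDist (x : 𝒳) (E : Set 𝒳) (n : ℕ) : Measure 𝒳 :=
  ((mc.law x).restrict {ω | ∀ i ≤ n, ω i ∈ E}).map (fun ω => ω n)

variable {E : Set 𝒳}

lemma measurableSet_forall_le_mem (hE : MeasurableSet E) (n : ℕ) :
    MeasurableSet {ω : ℕ → 𝒳 | ∀ i ≤ n, ω i ∈ E} := by
  simp only [ofPred_forall]
  exact MeasurableSet.iInter fun i => MeasurableSet.iInter fun _ => measurable_pi_apply i hE

lemma law_stay_inter_succ (x : 𝒳) (hE : MeasurableSet E) (n : ℕ) {S : Set 𝒳}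
    (hS : MeasurableSet S) :
    mc.law x ({ω | ∀ i ≤ n, ω i ∈ E} ∩ {ω | ω (n + 1) ∈ S}) =
      ∫⁻ y, mc.P y S ∂mc.tabooDist x E n := by
  rw [mc.law_markov x n _ S (measurableSet_forall_le_mem hE n) hS, tabooDist,
    lintegral_map (mc.P.measurable_coe hS) (measurable_pi_apply n)]
  intro ω ω' h
  exact forall₂_congr fun i hi => by rw [h i hi]

lemma tabooDist_succ (x : 𝒳) (hE : MeasurableSet E) (n : ℕ) :
    mc.tabooDist x E (n + 1) = ((mc.tabooDist x E n).bind mc.P).restrict E := by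
  ext S hS
  rw [Measure.restrict_apply hS, Measure.bind_apply (hS.inter hE) mc.P.measurable.aemeasurable,
    ← mc.law_stay_inter_succ x hE n (hS.inter hE), tabooDist,
    Measure.map_apply (measurable_pi_apply _) hS,
    Measure.restrict_apply (measurable_pi_apply _ hS)]
  congr 1
  ext ω
  simp only [mem_inter_iff, mem_preimage, mem_ofPred_eq, Nat.le_succ_iff]
  constructor
  · rintro ⟨h, h'⟩
    exact ⟨fun i hi => h' i (Or.inl hi), h, h' _ (Or.inr rfl)⟩
  · rintro ⟨h, h', h''⟩
    refine ⟨h', ?_⟩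
    rintro i (hi | rfl)
    exacts [h i hi, h'']

lemma ae_tabooDist_mem (x : 𝒳) (hE : MeasurableSet E) (n : ℕ) :
    ∀ᵐ y ∂mc.tabooDist x E n, y ∈ E := by
  refine (ae_map_iff (measurable_pi_apply n).aemeasurable (by exact hE)).2 ?_
  filter_upwards [ae_restrict_mem (measurableSet_forall_le_mem hE n)] with ω hω
  exact hω n le_rfl

/-- A function that is superharmonic on `E` and at least `1` on a set `U` disjoint from `E`
dominates, on `E`, the probability that the chain moves to `U` directly from `E`. -/
lemma law_exit_le_of_superharmonic {U : Set 𝒳} (hE : MeasurableSet E) (hU : MeasurableSet U)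
    (hUE : Disjoint U E) {h : 𝒳 → ℝ≥0∞} (hm : Measurable h) (hU1 : ∀ y ∈ U, 1 ≤ h y)
    (hsup : ∀ y ∈ E, ∫⁻ z, h z ∂mc.P y ≤ h y) (x : 𝒳) :
    mc.law x (⋃ n : ℕ, {ω | ∀ i ≤ n, ω i ∈ E} ∩ {ω | ω (n + 1) ∈ U}) ≤ h x := by
  have hstep (n : ℕ) : mc.law x ({ω | ∀ i ≤ n, ω i ∈ E} ∩ {ω | ω (n + 1) ∈ U}) +
      ∫⁻ y, h y ∂mc.tabooDist x E (n + 1) ≤ ∫⁻ y, h y ∂mc.tabooDist x E n := by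
    rw [mc.law_stay_inter_succ x hE n hU, mc.tabooDist_succ x hE n,
      ← Measure.bind_apply hU mc.P.measurable.aemeasurable]
    calc _ ≤ ∫⁻ y in U, h y ∂(mc.tabooDist x E n).bind mc.P +
          ∫⁻ y in E, h y ∂(mc.tabooDist x E n).bind mc.P := by
          gcongr
          rw [← setLIntegral_one]
          exact setLIntegral_mono' hU hU1
      _ = ∫⁻ y in U ∪ E, h y ∂(mc.tabooDist x E n).bind mc.P :=
          (lintegral_union hE hUE).symm
      _ ≤ ∫⁻ y, h y ∂(mc.tabooDist x E n).bind mc.P := setLIntegral_le_lintegral _ _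
      _ = ∫⁻ y, ∫⁻ z, h z ∂mc.P y ∂mc.tabooDist x E n :=
          Measure.lintegral_bind mc.P.measurable.aemeasurable hm.aemeasurable
      _ ≤ ∫⁻ y, h y ∂mc.tabooDist x E n := by
          refine lintegral_mono_ae ?_
          filter_upwards [mc.ae_tabooDist_mem x hE n] with y hy using hsup y hy
  have hsum (N : ℕ) :
      ∑ n ∈ Finset.range N, mc.law x ({ω | ∀ i ≤ n, ω i ∈ E} ∩ {ω | ω (n + 1) ∈ U}) +
        ∫⁻ y, h y ∂mc.tabooDist x E N ≤ ∫⁻ y, h y ∂mc.tabooDist x E 0 := by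
    induction N with
    | zero => simp
    | succ N ih =>
      rw [Finset.sum_range_succ, add_assoc]
      exact (add_le_add le_rfl (hstep N)).trans ih
  have hzero : ∫⁻ y, h y ∂mc.tabooDist x E 0 ≤ h x := by
    rw [tabooDist, lintegral_map hm (measurable_pi_apply 0)]
    refine (setLIntegral_le_lintegral _ _).trans ?_
    rw [← lintegral_map hm (measurable_pi_apply 0), mc.map_law_zero, lintegral_dirac' _ hm]
  refine (measure_iUnion_le _).trans (ENNReal.tsum_le_of_sum_range_le fun N => ?_)
  exact le_self_add.trans ((hsum N).trans hzero)

end MarkovChain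

lemma exists_hit_of_hitTime_lt {𝒳 : Type*} {s t : Set 𝒳} {ω : ℕ → 𝒳}
    (h : hitTime s ω < hitTime t ω) : ∃ n, ω n ∈ s ∧ ∀ i ≤ n, ω i ∉ t := by
  simp only [hitTime, iInf_lt_iff] at h
  obtain ⟨n, hn, hlt⟩ := h
  refine ⟨n, hn, fun i hi hit => hlt.not_ge ?_⟩
  exact (iInf₂_le i hit).trans (by exact_mod_cast hi)

namespace LDrift

variable {𝒳 : Type*} [TopologicalSpace 𝒳] [MeasurableSpace 𝒳] {mc : MarkovChain 𝒳}
  {V : 𝒳 → ℝ} {φ Ψ : ℝ → ℝ}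

lemma rφ_pos (ld : LDrift mc V φ Ψ) {r : ℝ} (hr : 1 ≤ r) : 0 < r * φ (1 / r) := by
  have h1 : (r + 1) * φ (1 / (r + 1)) < r * φ (1 / r) :=
    ld.rφ_anti (mem_Ici.2 hr) (mem_Ici.2 (by linarith)) (by linarith)
  have h2 : 0 ≤ φ (1 / (r + 1)) :=
    ld.φ_nonneg _ ⟨by positivity, by rw [div_le_one (by linarith)]; linarith⟩
  nlinarith

variable [BorelSpace 𝒳]

/-- A stationary chain jumps with positive probability over some level gap above `ℓ₀`. -/
lemma exists_jump (ld : LDrift mc V φ Ψ) {π : Measure 𝒳} [NeZero π]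
    (hinv : π.bind (fun x => mc.P x) = π) :
    ∃ ℓ m, ld.ℓ₀ < ℓ ∧ 0 < m ∧ ∫⁻ x in {x | V x < ℓ}, mc.P x {y | ℓ + m ≤ V y} ∂π ≠ 0 := by
  by_contra! hcon
  have hV : Measurable V := ld.V_cont.measurable
  set a : ℕ → ℕ → ℝ := fun k n => ld.ℓ₀ + k + 2 - 1 / (n + 1) with ha
  have ha_lt (k n : ℕ) : a k n < a k (n + 1) := by
    have : (1 : ℝ) / ((n + 1 : ℕ) + 1) < 1 / (n + 1) :=
      one_div_lt_one_div_of_lt (by positivity) (by push_cast; linarith)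
    simp only [ha]
    linarith
  have ha_gt (k n : ℕ) : ld.ℓ₀ + k < a k n := by
    have : (1 : ℝ) / (n + 1) ≤ 1 := by
      rw [div_le_one (by positivity)]
      linarith [n.cast_nonneg (α := ℝ)]
    simp only [ha]
    linarith
  have hPm (k n : ℕ) : Measurable fun y => mc.P y {z | a k n ≤ V z} :=
    mc.P.measurable_coe (measurableSet_le measurable_const hV)
  let G : Set 𝒳 := {y | ∀ k n, V y < a k n → mc.P y {z | a k (n + 1) ≤ V z} = 0}
  have hG : MeasurableSet G := by
    simp only [G, ofPred_forall]
    refine MeasurableSet.iInter fun k => MeasurableSet.iInter fun n => ?_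
    simp only [← ge_iff_le, imp_iff_not_or, ofPred_or]
    exact (measurableSet_lt hV measurable_const).compl.union
      (hPm k (n + 1) (measurableSet_singleton 0))
  have hGπ : π Gᶜ = 0 := by
    change ∀ᵐ y ∂π, ∀ k n, V y < a k n → mc.P y {z | a k (n + 1) ≤ V z} = 0
    refine ae_all_iff.2 fun k => ae_all_iff.2 fun n => ?_
    have h := hcon (a k n) (a k (n + 1) - a k n)
      (by linarith [ha_gt k n, k.cast_nonneg (α := ℝ)]) (by linarith [ha_lt k n])
    rw [add_sub_cancel, lintegral_eq_zero_iff (hPm k (n + 1))] at h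
    exact (ae_restrict_iff' (measurableSet_lt hV measurable_const)).1 h
  obtain ⟨x, hx⟩ := (ae_all_iff.2 fun n =>
    mc.ae_law_preimage_eq_zero hinv n hG.compl hGπ).exists
  obtain ⟨k, hk⟩ := exists_nat_gt (V x - ld.ℓ₀)
  have hbd (n : ℕ) : mc.law x {ω | ω n ∈ {y | a k n ≤ V y}} = 0 := by
    induction n with
    | zero =>
      refine mc.law_preimage_zero x (measurableSet_le measurable_const hV) ?_
      simp only [mem_ofPred_eq, not_le]
      linarith [ha_gt k 0]
    | succ n ih =>
      rw [mc.law_preimage_succ x n (measurableSet_le measurable_const hV)]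
      refine (lintegral_eq_zero_iff
        ((hPm k (n + 1)).comp (measurable_pi_apply (X := fun _ => 𝒳) n))).2 ?_
      filter_upwards [measure_eq_zero_iff_ae_notMem.1 ih, measure_eq_zero_iff_ae_notMem.1 (hx n)]
        with ω h1 h2
      simp only [not_le] at h1
      simp only [mem_compl_iff, not_not] at h2
      exact h2 k n h1
  have hzero : mc.law x (nonConfined V) = 0 := by
    refine measure_mono_null (fun ω hω => ?_) (measure_iUnion_null hbd)
    obtain ⟨n, hn⟩ := (hω (ld.ℓ₀ + k + 2)).exists
    refine mem_iUnion.2 ⟨n, ?_⟩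
    have : (0 : ℝ) < 1 / (n + 1) := by positivity
    simp only [mem_ofPred_eq, ha]
    linarith
  exact one_ne_zero ((ld.nonconf x).symm.trans hzero)

/-- While `V ≥ r`, the drift condition makes `(1 - r / V)⁺ / (r φ(1/r))` lose at most one
unit per step on average. -/
lemma ofReal_one_sub_div_le (ld : LDrift mc V φ Ψ) {r : ℝ} (hr : 1 ≤ r) {x : 𝒳}
    (hx : r ≤ V x) :
    ENNReal.ofReal ((1 - r * (V x)⁻¹) / (r * φ (1 / r))) ≤
      1 + ∫⁻ y, ENNReal.ofReal ((1 - r * (V y)⁻¹) / (r * φ (1 / r))) ∂mc.P x := by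
  have := mc.isMarkov
  have hV : Measurable V := ld.V_cont.measurable
  have hVpos (y : 𝒳) : 0 < V y := one_pos.trans_le (ld.V_one_le y)
  have hδ := ld.rφ_pos hr
  set δ := r * φ (1 / r) with hδ_def
  have hint : Integrable (fun y => (V y)⁻¹) (mc.P x) := by
    refine Integrable.of_bound hV.inv.aestronglyMeasurable 1 (ae_of_all _ fun y => ?_)
    rw [Real.norm_of_nonneg (inv_nonneg.2 (hVpos y).le)]
    exact inv_le_one_of_one_le₀ (ld.V_one_le y)
  have hint' : Integrable (fun y => (1 - r * (V y)⁻¹) / δ) (mc.P x) :=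
    ((integrable_const 1).sub (hint.const_mul r)).div_const δ
  have hφ : r * φ (V x)⁻¹ ≤ δ := by
    have h1 : V x * φ (1 / V x) ≤ r * φ (1 / r) :=
      ld.rφ_anti.antitoneOn (mem_Ici.2 hr) (mem_Ici.2 (ld.V_one_le x)) hx
    rw [one_div (V x)] at h1
    have h2 : 0 ≤ φ (V x)⁻¹ :=
      ld.φ_nonneg _ ⟨inv_pos.2 (hVpos x), inv_le_one_of_one_le₀ (ld.V_one_le x)⟩
    exact (mul_le_mul_of_nonneg_right hx h2).trans h1
  have hdrift : ∫ y, (V y)⁻¹ ∂mc.P x ≤ (V x)⁻¹ + φ (V x)⁻¹ := by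
    have h1 := ld.drift x
    have h2 : 0 ≤ if V x ≤ ld.ℓ₀ then ld.b else 0 := by
      split_ifs
      exacts [ld.b_nonneg, le_rfl]
    linarith
  have hreal : (1 - r * (V x)⁻¹) / δ ≤ 1 + ∫ y, (1 - r * (V y)⁻¹) / δ ∂mc.P x := by
    rw [integral_div, integral_sub (integrable_const 1) (hint.const_mul r), integral_const_mul,
      ← sub_le_iff_le_add', div_sub_one hδ.ne']
    simp only [integral_const, probReal_univ, smul_eq_mul, mul_one]
    refine (div_le_div_iff_of_pos_right hδ).2 ?_
    nlinarith [mul_le_mul_of_nonneg_left hdrift (zero_le_one.trans hr)]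
  calc _ ≤ ENNReal.ofReal (1 + ∫ y, (1 - r * (V y)⁻¹) / δ ∂mc.P x) :=
        ENNReal.ofReal_le_ofReal hreal
    _ ≤ 1 + ENNReal.ofReal (∫ y, (1 - r * (V y)⁻¹) / δ ∂mc.P x) := by
        simpa using ENNReal.ofReal_add_le (p := 1)
    _ ≤ _ := by
        gcongr
        calc _ ≤ ENNReal.ofReal (∫ y, max ((1 - r * (V y)⁻¹) / δ) 0 ∂mc.P x) :=
              ENNReal.ofReal_le_ofReal
                (integral_mono hint' hint'.pos_part fun y => le_max_left _ _)
          _ = _ := by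
              rw [ofReal_integral_eq_lintegral_ofReal hint'.pos_part
                (ae_of_all _ fun y => le_max_right _ _)]
              simp

/-- The excursion bound: `π {V ≥ r}` is at least the stationary rate of jumps from `{V < ℓ}`
to `{V ≥ ℓ + m}`, times the probability of then reaching level `r / (1 - q)` before
returning below `ℓ`, times the expected time above `r` from there. -/
lemma le_measure_tail (ld : LDrift mc V φ Ψ) {π : Measure 𝒳} [IsFiniteMeasure π]
    (hinv : π.bind (fun x => mc.P x) = π) {q : ℝ} (hq : q ∈ Ioo (0 : ℝ) 1) {ℓ m r : ℝ}
    (hℓ : ld.ℓ₀ < ℓ) (hm : 0 < m) (hr : ℓ + m < r) :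
    (∫⁻ x in {x | V x < ℓ}, mc.P x {y | ℓ + m ≤ V y} ∂π) *
      (ENNReal.ofReal (q / (r * φ (1 / r))) *
        ENNReal.ofReal (ld.Cconst ℓ m / Ψ (r / (1 - q)))) ≤ π {x | r ≤ V x} := by
  have := mc.isMarkov
  have hV : Measurable V := ld.V_cont.measurable
  have hr1 : 1 ≤ r := by linarith [ld.one_le_ℓ₀]
  have hδ := ld.rφ_pos hr1
  set δ := r * φ (1 / r) with hδ_def
  set R := r / (1 - q) with hR_def
  have hq1 : 0 < 1 - q := by linarith [hq.2]
  have hrR : r ≤ R := by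
    rw [hR_def, le_div_iff₀ hq1]
    nlinarith [hq.1]
  set U : Set 𝒳 := {y | R < V y} with hU_def
  set E : Set 𝒳 := {y | ℓ ≤ V y ∧ V y ≤ R} with hE_def
  have hU : MeasurableSet U := measurableSet_lt measurable_const hV
  have hE : MeasurableSet E :=
    (measurableSet_le measurable_const hV).inter (measurableSet_le hV measurable_const)
  have hUE : Disjoint U E := disjoint_left.2 fun y hyU hyE => not_le.2 hyU hyE.2
  set h : 𝒳 → ℝ≥0∞ := fun x => ⨆ n, mc.P.hitProb U E n x with hh_def
  have hh : Measurable h := .iSup (Kernel.measurable_hitProb hU hE)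
  have hh1 (x : 𝒳) : h x ≤ 1 := iSup_le fun n => Kernel.hitProb_le_one n x
  have hhU (x : 𝒳) (hx : x ∈ U) : h x = 1 := by
    simp [hh_def, Kernel.hitProb_of_mem _ hx]
  have hhE (x : 𝒳) (hx : x ∈ E) : h x = ∫⁻ y, h y ∂mc.P x :=
    Kernel.iSup_hitProb_eq_lintegral hU hE (disjoint_right.1 hUE hx) hx
  have hlow (x : 𝒳) (hx : ℓ + m ≤ V x) :
      ENNReal.ofReal (ld.Cconst ℓ m / Ψ R) ≤ h x := by
    by_cases hxU : x ∈ U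
    · rw [hhU x hxU, ← ENNReal.ofReal_one]
      have hC := ld.Cconst_mem ℓ m hℓ hm
      have hΨ := ld.Ψ_one_le R (hr1.trans hrR)
      exact ENNReal.ofReal_le_ofReal ((div_le_one (by linarith)).2 (by linarith [hC.2]))
    refine (ld.hit_lb ℓ m hℓ hm R (hr.trans_le hrR) x hx).trans ?_
    refine le_trans ?_ (mc.law_exit_le_of_superharmonic hE hU hUE hh
      (fun y hy => (hhU y hy).ge) (fun y hy => (hhE y hy).ge) x)
    have h0 : ∀ᵐ ω ∂mc.law x, ω 0 ∉ U :=
      measure_eq_zero_iff_ae_notMem.1 (mc.law_preimage_zero x hU hxU)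
    refine measure_mono_ae ?_
    filter_upwards [h0] with ω hω hlt
    obtain ⟨n, hn, hstay⟩ := exists_hit_of_hitTime_lt hlt
    classical
    have hex : ∃ n, ω n ∈ U := ⟨n, hn⟩
    obtain ⟨k, hk⟩ := Nat.exists_eq_succ_of_ne_zero
      (fun h0 : Nat.find hex = 0 => hω (h0 ▸ Nat.find_spec hex))
    refine mem_iUnion.2 ⟨k, fun i hi => ?_, ?_⟩
    · have hik : i < Nat.find hex := by omega
      exact ⟨not_lt.1 (hstay i (hik.le.trans (Nat.find_min' hex hn))),
        not_lt.1 (Nat.find_min hex hik)⟩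
    · have := Nat.find_spec hex
      rwa [hk] at this
  set c := ENNReal.ofReal (q / δ) with hc_def
  set w₀ : 𝒳 → ℝ≥0∞ := fun x => ENNReal.ofReal ((1 - r * (V x)⁻¹) / δ) with hw₀_def
  have hw₀m : Measurable w₀ :=
    ((measurable_const.sub (hV.inv.const_mul r)).div_const δ).ennreal_ofReal
  have hVpos (y : 𝒳) : 0 < V y := one_pos.trans_le (ld.V_one_le y)
  have hw₀zero (x : 𝒳) (hx : V x ≤ r) : w₀ x = 0 := by
    refine ENNReal.ofReal_of_nonpos (div_nonpos_of_nonpos_of_nonneg ?_ hδ.le)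
    rw [← div_eq_mul_inv, sub_nonpos, one_le_div (hVpos x)]
    exact hx
  have hw₀U (x : 𝒳) (hx : x ∈ U) : c ≤ w₀ x := by
    refine ENNReal.ofReal_le_ofReal ((div_le_div_iff_of_pos_right hδ).2 ?_)
    have : r < V x * (1 - q) := (div_lt_iff₀ hq1).1 hx
    rw [← div_eq_mul_inv, le_sub_comm, div_le_iff₀ (hVpos x)]
    linarith
  have hw₀le (x : 𝒳) : w₀ x ≤ ENNReal.ofReal (1 / δ) := by
    refine ENNReal.ofReal_le_ofReal ((div_le_div_iff_of_pos_right hδ).2 ?_)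
    have := mul_nonneg (zero_le_one.trans hr1) (inv_nonneg.2 (hVpos x).le)
    linarith
  set w : 𝒳 → ℝ≥0∞ := fun x => max (w₀ x) (c * h x) with hw_def
  have hwm : Measurable w := hw₀m.max (hh.const_mul c)
  have hch (x : 𝒳) (hx : x ∈ E) : c * h x ≤ ∫⁻ y, w y ∂mc.P x := by
    rw [hhE x hx, ← lintegral_const_mul c hh]
    exact lintegral_mono fun y => le_max_right _ _
  have hwle (x : 𝒳) : w x ≤ ENNReal.ofReal (1 / δ) + c :=
    max_le ((hw₀le x).trans le_self_add)
      ((mul_le_of_le_one_right' (hh1 x)).trans le_add_self)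
  have hfin : ∫⁻ x, w x ∂π ≠ ∞ := by
    refine ne_top_of_le_ne_top ?_ (lintegral_mono hwle)
    rw [lintegral_const]
    exact ENNReal.mul_ne_top (by simp [hc_def]) (measure_ne_top _ _)
  have hwB (x : 𝒳) (hx : x ∈ {x | V x < ℓ}) : w x = 0 := by
    have hx : V x < ℓ := hx
    have hxU : x ∉ U := fun hxU : R < V x => by linarith
    have hxE : x ∉ E := fun hxE => not_le.2 hx hxE.1
    simp [hw_def, hw₀zero x (by linarith), hh_def, Kernel.hitProb_of_notMem _ hxU hxE]
  have hsub (x : 𝒳) (hx : x ∉ {x | V x < ℓ}) :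
      w x ≤ {x | r ≤ V x}.indicator 1 x + ∫⁻ y, w y ∂mc.P x := by
    have hw₀sub : w₀ x ≤ {x | r ≤ V x}.indicator 1 x + ∫⁻ y, w y ∂mc.P x := by
      rcases lt_or_ge (V x) r with hxr | hxr
      · simp [hw₀zero x hxr.le]
      · rw [indicator_of_mem (by exact hxr), Pi.one_apply]
        refine (ld.ofReal_one_sub_div_le hr1 hxr).trans ?_
        gcongr
        exact le_max_left _ _
    refine max_le hw₀sub ?_
    by_cases hxU : x ∈ U
    · rw [hhU x hxU, mul_one]
      exact (hw₀U x hxU).trans hw₀sub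
    · exact (hch x ⟨not_lt.1 hx, not_lt.1 hxU⟩).trans le_add_self
  refine le_trans ?_ (Kernel.setLIntegral_lintegral_le_of_subsolution hinv
    (measurableSet_le measurable_const hV) (measurableSet_lt hV measurable_const)
    hwm hwB hsub hfin)
  have hjump : MeasurableSet {y | ℓ + m ≤ V y} := measurableSet_le measurable_const hV
  rw [← lintegral_mul_const _ (mc.P.measurable_coe hjump)]
  refine lintegral_mono fun x => ?_
  rw [mul_comm, ← setLIntegral_const]
  refine (setLIntegral_mono' hjump fun y hy => ?_).trans (setLIntegral_le_lintegral _ _)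
  exact (mul_le_mul_right (hlow y hy) c).trans (le_max_right _ _)

end LDrift

/-- **Theorem (tails of the invariant measure).**
Under the standard setup and the L-drift condition, for any increasing `D : [1,∞) → [1,∞)`
tending to infinity and any `q ∈ (0,1)`, setting
`L_q(r) = r φ(1/r) Ψ(r/(1-q)²) D(r)`, there exists `c_q ∈ (0,1)` such that
`c_q / L_q(r) ≤ π({V ≥ r})` for all `r ≥ 1`. -/
theorem invariant_measure_tail_lower_bound
    {𝒳 : Type*} [TopologicalSpace 𝒳] [LocallyCompactSpace 𝒳]
    [MeasurableSpace 𝒳] [BorelSpace 𝒳]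
    (mc : MarkovChain 𝒳) (setup : StdSetup mc)
    (V : 𝒳 → ℝ) (φ Ψ : ℝ → ℝ) (ld : LDrift mc V φ Ψ)
    (D : ℝ → ℝ) (D_one_le : ∀ r, 1 ≤ r → 1 ≤ D r)
    (D_mono : StrictMonoOn D (Set.Ici 1))
    (D_tendsto : Tendsto D atTop atTop)
    (q : ℝ) (hq : q ∈ Set.Ioo (0 : ℝ) 1) :
    ∃ c : ℝ, c ∈ Set.Ioo (0 : ℝ) 1 ∧ ∀ r, 1 ≤ r →
      ENNReal.ofReal (c / (r * φ (1 / r) * Ψ (r / (1 - q) ^ 2) * D r)) ≤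
        setup.π {x | r ≤ V x} := by
  have := setup.π_prob
  have := mc.isMarkov
  obtain ⟨ℓ, m, hℓ, hm, hβ⟩ := ld.exists_jump setup.π_inv
  set β := ∫⁻ x in {x | V x < ℓ}, mc.P x {y | ℓ + m ≤ V y} ∂setup.π with hβ_def
  have hβ_top : β ≠ ∞ := by
    refine ne_top_of_le_ne_top (b := setup.π {x | V x < ℓ}) (measure_ne_top _ _) ?_
    rw [← setLIntegral_one]
    exact lintegral_mono fun x => prob_le_one
  have hβ_pos : 0 < β.toReal := ENNReal.toReal_pos hβ hβ_top
  have hC := (ld.Cconst_mem ℓ m hℓ hm).1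
  set C := ld.Cconst ℓ m with hC_def
  have hq0 := hq.1
  have hq1 : 0 < 1 - q := by linarith [hq.2]
  have hle_div {r : ℝ} (hr : 1 ≤ r) : r ≤ r / (1 - q) := by
    rw [le_div_iff₀ hq1]
    nlinarith
  have hdiv_le {r : ℝ} (hr : 1 ≤ r) : r / (1 - q) ≤ r / (1 - q) ^ 2 := by
    gcongr
    nlinarith
  have htail {r : ℝ} (hr : ℓ + m < r) :
      ENNReal.ofReal (β.toReal * (q / (r * φ (1 / r)) * (C / Ψ (r / (1 - q))))) ≤
        setup.π {x | r ≤ V x} := by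
    have hr1 : 1 ≤ r := by linarith [ld.one_le_ℓ₀]
    have hδ := ld.rφ_pos hr1
    rw [ENNReal.ofReal_mul hβ_pos.le, ENNReal.ofReal_mul (by positivity),
      ENNReal.ofReal_toReal hβ_top]
    exact ld.le_measure_tail setup.π_inv hq hℓ hm hr
  set r₀ := ℓ + m + 1 with hr₀_def
  have hr₀ : 1 ≤ r₀ := by linarith [ld.one_le_ℓ₀]
  have hΨ₀ := ld.Ψ_one_le _ (hr₀.trans (hle_div hr₀))
  set K := β.toReal * q * C / Ψ (r₀ / (1 - q)) with hK_def
  have hK : 0 < K := by positivity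
  refine ⟨min K (1 / 2), ⟨by positivity, (min_le_right _ _).trans_lt (by norm_num)⟩,
    fun r hr => ?_⟩
  have hδ := ld.rφ_pos hr
  have hD := D_one_le r hr
  have hmem : r / (1 - q) ∈ Ici (1 : ℝ) := hr.trans (hle_div hr)
  have hmem' : r / (1 - q) ^ 2 ∈ Ici (1 : ℝ) := le_trans hmem (hdiv_le hr)
  have hΨ := ld.Ψ_one_le _ hmem
  have hΨ' := ld.Ψ_one_le _ hmem'
  rcases lt_or_ge (ℓ + m) r with hr' | hr'
  · refine (ENNReal.ofReal_le_ofReal ?_).trans (htail hr')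
    have hKC : K ≤ β.toReal * q * C := div_le_self (by positivity) hΨ₀
    calc min K (1 / 2) / (r * φ (1 / r) * Ψ (r / (1 - q) ^ 2) * D r)
        ≤ β.toReal * q * C / (r * φ (1 / r) * Ψ (r / (1 - q))) := by
          refine div_le_div₀ (by positivity) ((min_le_left _ _).trans hKC) (by positivity) ?_
          calc r * φ (1 / r) * Ψ (r / (1 - q))
              ≤ r * φ (1 / r) * Ψ (r / (1 - q) ^ 2) :=
                mul_le_mul_of_nonneg_left
                  (ld.Ψ_mono.monotoneOn hmem hmem' (hdiv_le hr)) hδ.le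
            _ ≤ _ := le_mul_of_one_le_right (by positivity) hD
      _ = _ := by field_simp
  · have hrr₀ : r ≤ r₀ := by linarith
    have hδ₀ := ld.rφ_pos hr₀
    refine (ENNReal.ofReal_le_ofReal ?_).trans ((htail (r := r₀) (by linarith)).trans
      (measure_mono fun x (hx : r₀ ≤ V x) => hrr₀.trans hx))
    calc min K (1 / 2) / (r * φ (1 / r) * Ψ (r / (1 - q) ^ 2) * D r)
        ≤ K / (r₀ * φ (1 / r₀)) := by
          refine div_le_div₀ hK.le (min_le_left _ _) hδ₀ ?_
          calc r₀ * φ (1 / r₀) ≤ r * φ (1 / r) :=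
                ld.rφ_anti.antitoneOn (mem_Ici.2 hr) (mem_Ici.2 hr₀) hrr₀
            _ ≤ r * φ (1 / r) * Ψ (r / (1 - q) ^ 2) := le_mul_of_one_le_right hδ.le hΨ'
            _ ≤ _ := le_mul_of_one_le_right (by positivity) hD
      _ = _ := by
          rw [hK_def]
          field_simp
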